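/- Let M be a matroid on an n-element set E (n ≥ 1), and let Q'_M be the polynomial associated to a Q'-datum for M. Then Q'_M has total degree n − 1, and its homogeneous part of degree n − 1 equals (x + y)^{n−1}; that is, for all a, b with a + b = n − 1, the coefficient of x^a y^b in Q'_M is the binomial coefficient C(n−1, a). -/

import Mathlib

open scoped Pointwise
open Finset

noncomputable section

/-- The standard simplex `Δ = conv{e_i : i ∈ E}` in `ℝ^E`. -/
def stdSimplexSet (α : Type*) [Fintype α] [DecidableEq α] : Set (α → ℝ) :=
  convexHull ℝ {x : α → ℝ | ∃ i : α, x = Pi.single i (1 : ℝ)}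

/-- The number of lattice points (points of `ℤ^E`) in a subset of `ℝ^E`. -/
def latticeCount {α : Type*} (P : Set (α → ℝ)) : ℕ :=
  Set.ncard {q : α → ℤ | (fun i => (q i : ℝ)) ∈ P}

/-- `Qcount P t u` is the number of lattice points of `P + uΔ + t∇`. -/
def Qcount {α : Type*} [Fintype α] [DecidableEq α] (P : Set (α → ℝ)) (t u : ℕ) : ℕ :=
  latticeCount (P + (u : ℝ) • stdSimplexSet α + (t : ℝ) • (-stdSimplexSet α))

/-- A polymatroid on a finite ground set, given by its rank function. -/
structure PolyMatroid (α : Type*) [Fintype α] [DecidableEq α] where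
  rk : Finset α → ℕ
  rk_empty : rk ∅ = 0
  rk_mono : ∀ ⦃S T : Finset α⦄, S ⊆ T → rk S ≤ rk T
  rk_submod : ∀ S T : Finset α, rk (S ∪ T) + rk (S ∩ T) ≤ rk S + rk T

variable {α : Type*} [Fintype α] [DecidableEq α]

/-- A basis of a matroid (an independent spanning set). -/
def PolyMatroid.IsBasis (M : PolyMatroid α) (B : Finset α) : Prop :=
  M.rk B = B.card ∧ M.rk B = M.rk Finset.univ

/-- The indicator vector of a finite set. -/
def indicatorVec {α : Type*} [DecidableEq α] (B : Finset α) : α → ℝ :=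
  fun i => if i ∈ B then 1 else 0

/-- The base polytope of a matroid: the convex hull of indicator vectors of bases. -/
def matroidPolytope (M : PolyMatroid α) : Set (α → ℝ) :=
  convexHull ℝ {x : α → ℝ | ∃ B : Finset α, M.IsBasis B ∧ x = indicatorVec B}

/-- The base polytope of a polymatroid, by its inequality description. -/
def PolyMatroid.polytope (M : PolyMatroid α) : Set (α → ℝ) :=
  {x | (∑ i, x i) = (M.rk Finset.univ : ℝ) ∧
    ∀ S : Finset α, (∑ i ∈ S, x i) ≤ (M.rk S : ℝ)}

/-- `c : ℕ × ℕ → ℤ` is a `Q'`-datum for the counting function `Q` if it is finitely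
supported and interpolates `Q` in the binomial basis. -/
def IsQdatumFun (Q : ℕ → ℕ → ℕ) (c : ℕ × ℕ → ℤ) : Prop :=
  (Function.support c).Finite ∧
    ∀ t u : ℕ, (Q t u : ℤ) = ∑ᶠ p : ℕ × ℕ, c p * (t.choose p.1 : ℤ) * (u.choose p.2 : ℤ)

/-- A `Q'`-datum for the lattice-point counting function of the polytope `P`. -/
def IsQdatum (P : Set (α → ℝ)) (c : ℕ × ℕ → ℤ) : Prop :=
  IsQdatumFun (Qcount P) c

/-- The polynomial `Q'` associated to a `Q'`-datum, as a function on `ℚ × ℚ`. -/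
def Qprime (c : ℕ × ℕ → ℤ) (x y : ℚ) : ℚ :=
  ∑ᶠ p : ℕ × ℕ, (c p : ℚ) * (x - 1) ^ p.1 * (y - 1) ^ p.2

/-- The polynomial `Q'` associated to a `Q'`-datum, as a polynomial in two variables. -/
def QprimePoly (c : ℕ × ℕ → ℤ) : MvPolynomial (Fin 2) ℤ :=
  ∑ᶠ p : ℕ × ℕ,
    MvPolynomial.C (c p) * (MvPolynomial.X 0 - 1) ^ p.1 * (MvPolynomial.X 1 - 1) ^ p.2

/-- The Tutte polynomial of a matroid, as a function on `ℚ × ℚ`. -/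
def TuttePoly (M : PolyMatroid α) (x y : ℚ) : ℚ :=
  ∑ S : Finset α,
    (x - 1) ^ (M.rk Finset.univ - M.rk S) * (y - 1) ^ (S.card - M.rk S)



/-- The rank of an independent set of maximal cardinality is the rank of the matroid. -/
theorem PolyMatroid.exists_isBasis (M : PolyMatroid α) (hmat : ∀ i : α, M.rk {i} ≤ 1) :
    ∃ B, M.IsBasis B := by
  obtain ⟨B, hB, hmax⟩ := Finset.exists_max_image
    (Finset.univ.filter fun B : Finset α => M.rk B = B.card) Finset.card
    ⟨∅, by simp [M.rk_empty]⟩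
  simp only [Finset.mem_filter, Finset.mem_univ, true_and] at hB hmax
  have hins (e : α) : M.rk (insert e B) = M.rk B := by
    by_cases he : e ∈ B
    · rw [Finset.insert_eq_of_mem he]
    have h1 := M.rk_submod B {e}
    have h2 := hmat e
    have h3 : M.rk B ≤ M.rk (insert e B) := M.rk_mono (Finset.subset_insert e B)
    rw [show B ∪ {e} = insert e B by ext; simp] at h1
    by_contra hne
    have h4 := hmax (insert e B) (by rw [Finset.card_insert_of_notMem he]; omega)
    rw [Finset.card_insert_of_notMem he] at h4
    omega
  have hunion (S : Finset α) : M.rk (B ∪ S) = M.rk B := by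
    induction S using Finset.induction_on with
    | empty => simp
    | insert e S _ ih =>
      have h1 := M.rk_submod (B ∪ S) (insert e B)
      have h2 : M.rk B ≤ M.rk ((B ∪ S) ∩ insert e B) :=
        M.rk_mono fun x hx => by simp [hx]
      have h3 : M.rk B ≤ M.rk (B ∪ insert e S) := M.rk_mono Finset.subset_union_left
      rw [show B ∪ S ∪ insert e B = B ∪ insert e S by ext; simp; tauto, ih, hins] at h1
      omega
  exact ⟨B, hB, by
    rw [← hunion Finset.univ, Finset.union_eq_right.2 (Finset.subset_univ B)]⟩

theorem mem_smul_stdSimplexSet [Nonempty α] {u : ℕ} {x : α → ℝ} :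
    x ∈ (u : ℝ) • stdSimplexSet α ↔ (∀ i, 0 ≤ x i) ∧ ∑ i, x i = u := by
  have hΔ : stdSimplexSet α = stdSimplex ℝ α := by
    rw [← convexHull_rangle_single_eq_stdSimplex]
    unfold stdSimplexSet
    congr 1
    ext x
    simp [eq_comm]
  rw [hΔ, Set.mem_smul_set]
  constructor
  · rintro ⟨y, ⟨hy0, hy1⟩, rfl⟩
    refine ⟨fun i => mul_nonneg u.cast_nonneg (hy0 i), ?_⟩
    simp [← Finset.mul_sum, hy1]
  · rintro ⟨h0, h1⟩
    rcases Nat.eq_zero_or_pos u with rfl | hu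
    · obtain ⟨i⟩ := ‹Nonempty α›
      refine ⟨Pi.single i 1, single_mem_stdSimplex ℝ i, ?_⟩
      have := (Finset.sum_eq_zero_iff_of_nonneg fun i _ => h0 i).1 (by simpa using h1)
      ext j
      simp [this j]
    · have hu' : (u : ℝ) ≠ 0 := by positivity
      refine ⟨(u : ℝ)⁻¹ • x, ⟨fun i => ?_, ?_⟩, by simp [smul_smul, hu']⟩
      · have := h0 i
        simp only [Pi.smul_apply, smul_eq_mul]
        positivity
      · simp [← Finset.mul_sum, h1, hu']

theorem mem_smul_neg_stdSimplexSet [Nonempty α] {t : ℕ} {x : α → ℝ} :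
    x ∈ (t : ℝ) • (-stdSimplexSet α) ↔ (∀ i, x i ≤ 0) ∧ ∑ i, x i = -t := by
  rw [Set.smul_set_neg, Set.mem_neg, mem_smul_stdSimplexSet]
  simp [neg_eq_iff_eq_neg]

theorem matroidPolytope_subset [Nonempty α] (M : PolyMatroid α) :
    matroidPolytope M ⊆ ((M.rk Finset.univ : ℕ) : ℝ) • stdSimplexSet α := by
  refine convexHull_min ?_ ((convex_convexHull ℝ _).smul _)
  rintro _ ⟨B, hB, rfl⟩
  refine mem_smul_stdSimplexSet.2 ⟨fun i => ?_, ?_⟩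
  · unfold indicatorVec; split_ifs <;> simp
  · simp [indicatorVec, ← hB.2, hB.1]

theorem intCast_mem_simplex_add_neg_iff [Nonempty α] {t u : ℕ} {z : α → ℤ} :
    (fun i => (z i : ℝ)) ∈ (u : ℝ) • stdSimplexSet α + (t : ℝ) • (-stdSimplexSet α) ↔
      ∑ i, z i = u - t ∧ ∑ i, (z i).toNat ≤ u := by
  rw [Set.mem_add]
  constructor
  · rintro ⟨p, hp, q, hq, hpq⟩
    rw [mem_smul_stdSimplexSet] at hp
    rw [mem_smul_neg_stdSimplexSet] at hq
    have hpq' (i) : p i + q i = z i := congrFun hpq i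
    constructor
    · have : (∑ i, (z i : ℝ)) = u - t := by
        simp_rw [← hpq', Finset.sum_add_distrib, hp.2, hq.2]; ring
      exact_mod_cast this
    · have : (∑ i, ((z i).toNat : ℝ)) ≤ u := by
        rw [← hp.2]
        refine Finset.sum_le_sum fun i _ => ?_
        rcases le_total 0 (z i) with h | h
        · have h' : (((z i).toNat : ℤ) : ℝ) = z i := by rw [Int.toNat_of_nonneg h]
          have := hq.1 i
          have := hpq' i
          rw [← Int.cast_natCast, h']
          linarith
        · simpa [Int.toNat_of_nonpos h] using hp.1 i
      exact_mod_cast this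
  · rintro ⟨h1, h2⟩
    obtain ⟨e⟩ := ‹Nonempty α›
    have h1' : (∑ i, (z i : ℝ)) = u - t := by exact_mod_cast h1
    have h2' : (∑ i, ((z i).toNat : ℝ)) ≤ u := by exact_mod_cast h2
    have key (i) : (z i : ℝ) = ((z i).toNat : ℝ) - ((-z i).toNat : ℝ) := by
      have : z i = ((z i).toNat : ℤ) - ((-z i).toNat : ℤ) := by omega
      exact_mod_cast this
    have h3 : (∑ i, ((-z i).toNat : ℝ)) = ∑ i, ((z i).toNat : ℝ) - (u - t) := by
      rw [← h1', Finset.sum_congr rfl fun i _ => key i, Finset.sum_sub_distrib]; ring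
    set d : ℝ := u - ∑ i, ((z i).toNat : ℝ) with hd
    have hd0 : 0 ≤ d := by linarith
    have hs (i) : 0 ≤ (Pi.single e d : α → ℝ) i := by
      rw [Pi.single_apply]; split_ifs <;> simp [hd0]
    refine ⟨fun i => (z i).toNat + (Pi.single e d : α → ℝ) i,
      mem_smul_stdSimplexSet.2 ⟨fun i => add_nonneg (Nat.cast_nonneg _) (hs i), ?_⟩,
      fun i => -((-z i).toNat + (Pi.single e d : α → ℝ) i),
      mem_smul_neg_stdSimplexSet.2
        ⟨fun i => neg_nonpos.2 (add_nonneg (Nat.cast_nonneg _) (hs i)), ?_⟩, ?_⟩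
    · simp [Finset.sum_add_distrib, hd]
    · rw [Finset.sum_neg_distrib, Finset.sum_add_distrib, h3, Finset.sum_pi_single']
      simp [hd]
    · ext i
      simp only [Pi.add_apply, key i]
      ring

/-- Integer vectors of length `m` whose positive part sums to at most `u` and whose negative part
sums to at most `t`. -/
def signedBall (m t u : ℕ) : Set (Fin m → ℤ) :=
  {w | ∑ i, (w i).toNat ≤ u ∧ ∑ i, (-w i).toNat ≤ t}

/-- The number of elements of `signedBall m t u`. -/
def signedBallCard (m t u : ℕ) : ℕ :=
  ∑ p ∈ Finset.HasAntidiagonal.antidiagonal m, m.choose p.1 * (u.choose p.1 * (t + p.2).choose p.2)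

/-- Splitting an element of `signedBall` into its first coordinate and the remaining ones. -/
def signedBallSuccEquiv (m t u : ℕ) :
    signedBall (m + 1) t u ≃
      Σ a : Finset.Icc (-(t : ℤ)) u, signedBall m (t - (-a.1).toNat) (u - a.1.toNat) where
  toFun w := ⟨⟨w.1 0, by
      have := w.2
      simp only [signedBall, Set.mem_ofPred_eq, Fin.sum_univ_succ] at this
      rw [Finset.mem_Icc]
      omega⟩, Fin.tail w.1, by
      have := w.2
      simp only [signedBall, Set.mem_ofPred_eq, Fin.sum_univ_succ, Fin.tail] at this ⊢
      omega⟩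
  invFun p := ⟨Fin.cons p.1.1 p.2.1, by
    have h1 := p.2.2
    have h2 := Finset.mem_Icc.1 p.1.2
    simp only [signedBall, Set.mem_ofPred_eq, Fin.sum_univ_succ, Fin.cons_zero,
      Fin.cons_succ] at h1 ⊢
    omega⟩
  left_inv w := by simp
  right_inv p := by
    obtain ⟨⟨a, ha⟩, w, hw⟩ := p
    rfl

theorem sum_Icc_neg_eq (f : ℤ → ℕ) (t u : ℕ) :
    ∑ a ∈ Finset.Icc (-(t : ℤ)) u, f a =
      ∑ k ∈ Finset.range (t + 1), f (-k) + ∑ k ∈ Finset.range u, f (k + 1) := by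
  have h : Finset.Icc (-(t : ℤ)) u = (Finset.range (t + 1)).image (fun k : ℕ => -(k : ℤ)) ∪
      (Finset.range u).image (fun k : ℕ => (k : ℤ) + 1) := by
    ext a
    simp only [Finset.mem_Icc, Finset.mem_union, Finset.mem_image, Finset.mem_range]
    constructor
    · intro h
      rcases le_or_gt a 0 with ha | ha
      · exact Or.inl ⟨(-a).toNat, by omega, by omega⟩
      · exact Or.inr ⟨(a - 1).toNat, by omega, by omega⟩
    · rintro (⟨k, hk, rfl⟩ | ⟨k, hk, rfl⟩) <;> omega
  rw [h, Finset.sum_union, Finset.sum_image, Finset.sum_image]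
  · intro a _ b _ h; simpa using h
  · intro a _ b _ h; simpa using h
  · rw [Finset.disjoint_left]
    simp only [Finset.mem_image, Finset.mem_range]
    rintro _ ⟨k, hk, rfl⟩ ⟨l, hl, h⟩
    omega

theorem signedBallCard_succ (m t u : ℕ) :
    signedBallCard (m + 1) t u =
      ∑ k ∈ Finset.range (t + 1), signedBallCard m (t - k) u +
        ∑ k ∈ Finset.range u, signedBallCard m t (u - (k + 1)) := by
  have h1 (s : ℕ) :
      ∑ k ∈ Finset.range (t + 1), (t - k + s).choose s = (t + (s + 1)).choose (s + 1) := by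
    rw [← Finset.sum_range_reflect, ← add_assoc, ← Nat.sum_range_add_choose t s]
    refine Finset.sum_congr rfl fun k hk => ?_
    rw [Finset.mem_range] at hk
    congr 2
    omega
  have h2 (s : ℕ) : ∑ k ∈ Finset.range u, (u - (k + 1)).choose s = u.choose (s + 1) := by
    induction u with
    | zero => simp
    | succ u ih => simp [Finset.sum_range_succ', ih, Nat.choose_succ_succ, add_comm]
  unfold signedBallCard
  rw [Finset.sum_comm, Finset.sum_comm (s := Finset.range u)]
  simp_rw [← Finset.mul_sum, ← Finset.sum_mul, h1, h2]
  have h3 := Finset.sum_antidiagonal_choose_succ_mul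
    (fun i j => u.choose i * (t + j).choose j) m
  simp only [Nat.cast_id] at h3
  rw [h3]
  congr 1
  refine Finset.sum_congr rfl fun p hp => ?_
  rw [Nat.choose_symm_of_eq_add (Finset.HasAntidiagonal.mem_antidiagonal.1 hp).symm]

theorem signedBall_finite_and_card (m t u : ℕ) :
    Finite (signedBall m t u) ∧ Nat.card (signedBall m t u) = signedBallCard m t u := by
  induction m generalizing t u with
  | zero =>
    have : signedBall 0 t u = Set.univ := by ext; simp [signedBall]
    rw [this]
    exact ⟨inferInstance, by simp [signedBallCard]⟩
  | succ m ih =>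
    have hf (a : Finset.Icc (-(t : ℤ)) u) :
      Finite (signedBall m (t - (-a.1).toNat) (u - a.1.toNat)) := (ih _ _).1
    refine ⟨Finite.of_equiv _ (signedBallSuccEquiv m t u).symm, ?_⟩
    rw [Nat.card_congr (signedBallSuccEquiv m t u), Nat.card_sigma]
    simp_rw [(ih _ _).2]
    rw [Finset.sum_coe_sort (Finset.Icc (-(t : ℤ)) u)
      (fun a => signedBallCard m (t - (-a).toNat) (u - a.toNat)), sum_Icc_neg_eq,
      signedBallCard_succ]
    congr 1
    all_goals
      refine Finset.sum_congr rfl fun k _ => ?_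
      congr 1
      · omega
      all_goals omega

/-- Integer points of `uΔ + t∇` are determined by all but one of their coordinates, and these range
over a `signedBall`. -/
theorem simplex_add_neg_finite_and_ncard [Nonempty α] (t u : ℕ) :
    {z : α → ℤ | (fun i => (z i : ℝ)) ∈
        (u : ℝ) • stdSimplexSet α + (t : ℝ) • (-stdSimplexSet α)}.Finite ∧
      {z : α → ℤ | (fun i => (z i : ℝ)) ∈
        (u : ℝ) • stdSimplexSet α + (t : ℝ) • (-stdSimplexSet α)}.ncard =
        signedBallCard (Fintype.card α - 1) t u := by
  obtain ⟨m, hm⟩ := Nat.exists_eq_succ_of_ne_zero (Fintype.card_ne_zero (α := α))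
  let e : Fin (m + 1) ≃ α := (Fintype.equivFinOfCardEq hm).symm
  simp_rw [intCast_mem_simplex_add_neg_iff]
  have hkey (z : α → ℤ) : ∑ i, z i = ∑ i, ((z i).toNat : ℤ) - ∑ i, ((-z i).toNat : ℤ) := by
    rw [← Finset.sum_sub_distrib]
    exact Finset.sum_congr rfl fun i _ => by omega
  have hbij : Set.BijOn (fun (z : α → ℤ) (i : Fin m) => z (e i.succ))
      {z : α → ℤ | ∑ i, z i = u - t ∧ ∑ i, (z i).toNat ≤ u} (signedBall m t u) := by
    refine ⟨?_, ?_, ?_⟩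
    · rintro z ⟨h1, h2⟩
      rw [hkey] at h1
      rw [← e.sum_comp, Fin.sum_univ_succ] at h2
      rw [← e.sum_comp, Fin.sum_univ_succ, ← e.sum_comp, Fin.sum_univ_succ] at h1
      refine ⟨?_, ?_⟩ <;> zify at h2 ⊢ <;> omega
    · rintro z ⟨h1, -⟩ w ⟨h1', -⟩ h
      have hs (i : Fin m) : z (e i.succ) = w (e i.succ) := congrFun h i
      rw [← e.sum_comp, Fin.sum_univ_succ] at h1 h1'
      simp_rw [hs] at h1
      ext a
      obtain ⟨i, rfl⟩ := e.surjective a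
      refine Fin.cases ?_ hs i
      omega
    · rintro w ⟨h1, h2⟩
      have hw : ∑ i, w i = ∑ i, ((w i).toNat : ℤ) - ∑ i, ((-w i).toNat : ℤ) := by
        rw [← Finset.sum_sub_distrib]
        exact Finset.sum_congr rfl fun i _ => by omega
      refine ⟨fun a => (Fin.cons (u - t - ∑ i, w i) w : Fin (m + 1) → ℤ) (e.symm a),
        ⟨?_, ?_⟩, ?_⟩
      · rw [← e.sum_comp, Fin.sum_univ_succ]
        simp
      · rw [← e.sum_comp, Fin.sum_univ_succ]
        simp only [Equiv.symm_apply_apply, Fin.cons_zero, Fin.cons_succ]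
        zify at h1 h2 ⊢
        omega
      · ext i
        simp
  have hcard := signedBall_finite_and_card m t u
  refine ⟨hbij.finite_iff_finite.2 hcard.1, ?_⟩
  rw [hbij.ncard_eq, hm]
  exact hcard.2

theorem Qcount_bounds [Nonempty α] (M : PolyMatroid α) (hmat : ∀ i : α, M.rk {i} ≤ 1) (t u : ℕ) :
    signedBallCard (Fintype.card α - 1) t u ≤ Qcount (matroidPolytope M) t u ∧
      Qcount (matroidPolytope M) t u ≤
        signedBallCard (Fintype.card α - 1) t (u + M.rk Finset.univ) := by
  obtain ⟨B, hB⟩ := M.exists_isBasis hmat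
  set r := M.rk Finset.univ
  have hsub : {z : α → ℤ | (fun i => (z i : ℝ)) ∈ matroidPolytope M +
        (u : ℝ) • stdSimplexSet α + (t : ℝ) • (-stdSimplexSet α)} ⊆
      {z : α → ℤ | (fun i => (z i : ℝ)) ∈
        ((u + r : ℕ) : ℝ) • stdSimplexSet α + (t : ℝ) • (-stdSimplexSet α)} := by
    refine fun z hz => Set.add_subset_add_right ?_ hz
    rintro _ ⟨p, hp, q, hq, rfl⟩
    have hp' := mem_smul_stdSimplexSet.1 (matroidPolytope_subset M hp)
    have hq' := mem_smul_stdSimplexSet.1 hq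
    refine mem_smul_stdSimplexSet.2 ⟨fun i => add_nonneg (hp'.1 i) (hq'.1 i), ?_⟩
    simp [Finset.sum_add_distrib, hp'.2, hq'.2, r, add_comm]
  obtain ⟨hfin, hcard⟩ := simplex_add_neg_finite_and_ncard (α := α) t (u + r)
  refine ⟨?_, ?_⟩
  · rw [← (simplex_add_neg_finite_and_ncard t u).2]
    refine Set.ncard_le_ncard_of_injOn (fun z i => (if i ∈ B then 1 else 0) + z i) ?_ ?_
      (hfin.subset hsub)
    · intro z hz
      have hv : indicatorVec B ∈ matroidPolytope M := subset_convexHull ℝ _ ⟨B, hB, rfl⟩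
      replace hz : (fun i => (z i : ℝ)) ∈
        (u : ℝ) • stdSimplexSet α + (t : ℝ) • (-stdSimplexSet α) := hz
      have := Set.add_mem_add hv hz
      rw [← add_assoc] at this
      rw [Set.mem_ofPred_eq]
      convert this using 2
      simp [indicatorVec]
    · intro z _ w _ h
      ext i
      simpa using congrFun h i
  · rw [← hcard]
    exact Set.ncard_le_ncard hsub hfin

open Filter Topology Nat in
theorem tendsto_choose_div_pow (x a i : ℕ) :
    Tendsto (fun k : ℕ => ((k * x + a).choose i : ℝ) / (k : ℝ) ^ i) atTop
      (𝓝 ((x : ℝ) ^ i / i !)) := by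
  induction i with
  | zero => simp
  | succ i ih =>
    have hlin : Tendsto (fun k : ℕ => (x : ℝ) + ((a : ℝ) - i) / k) atTop (𝓝 x) := by
      simpa using tendsto_const_nhds.add (tendsto_const_div_atTop_nhds_zero_nat ((a : ℝ) - i))
    have h := (ih.mul hlin).div_const ((i : ℝ) + 1)
    rw [show (x : ℝ) ^ (i + 1) / ((i + 1)! : ℕ) = (x : ℝ) ^ i / i ! * x / (i + 1) by
      rw [Nat.factorial_succ]; push_cast; field_simp; ring]
    refine h.congr' ?_
    filter_upwards [eventually_gt_atTop 0] with k hk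
    have hk' : (k : ℝ) ≠ 0 := by positivity
    have hc : ((k * x + a).choose (i + 1) : ℝ) * (i + 1) =
        (k * x + a).choose i * ((k * x + a : ℝ) - i) := by
      rcases le_or_gt i (k * x + a) with hi | hi
      · have := Nat.choose_succ_right_eq (k * x + a) i
        rify [hi] at this
        exact this
      · simp [Nat.choose_eq_zero_of_lt hi, Nat.choose_eq_zero_of_lt (hi.trans (Nat.lt_succ_self i))]
    rw [eq_div_iff (by positivity), div_mul_eq_mul_div, div_eq_iff (by positivity)] at *
    rw [hc]
    field_simp
    ring

open Filter Topology Nat in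
theorem tendsto_signedBallCard_div_pow (n x a : ℕ) :
    Tendsto (fun k : ℕ => (signedBallCard n (k * x) (k + a) : ℝ) / (k : ℝ) ^ n) atTop
      (𝓝 (∑ p ∈ Finset.HasAntidiagonal.antidiagonal n,
        (n.choose p.1 : ℝ) / (p.1 ! * p.2 !) * (x : ℝ) ^ p.1)) := by
  rw [← Finset.Nat.sum_antidiagonal_swap]
  have h : Tendsto (fun k : ℕ => ∑ p ∈ Finset.HasAntidiagonal.antidiagonal n, (n.choose p.1 : ℝ) *
      (((k * 1 + a).choose p.1 / (k : ℝ) ^ p.1) * ((k * x + p.2).choose p.2 / (k : ℝ) ^ p.2)))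
      atTop (𝓝 (∑ p ∈ Finset.HasAntidiagonal.antidiagonal n, (n.choose p.1 : ℝ) *
        (((1 : ℕ) : ℝ) ^ p.1 / p.1 ! * ((x : ℝ) ^ p.2 / p.2 !)))) :=
    tendsto_finsetSum _ fun p _ =>
      ((tendsto_choose_div_pow 1 a p.1).mul (tendsto_choose_div_pow x p.2 p.2)).const_mul _
  convert h using 2
  · rename_i k
    rw [signedBallCard]
    push_cast
    rw [Finset.sum_div]
    refine Finset.sum_congr rfl fun p hp => ?_
    rw [← Finset.HasAntidiagonal.mem_antidiagonal.1 hp, pow_add, mul_one]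
    ring
  · refine Finset.sum_congr rfl fun p hp => ?_
    simp only [Prod.fst_swap, Prod.snd_swap]
    rw [← Nat.choose_symm_of_eq_add (Finset.HasAntidiagonal.mem_antidiagonal.1 hp).symm]
    simp only [Nat.cast_one, one_pow]
    ring

open Filter Topology Nat in
theorem tendsto_sum_choose_div_pow {S : Finset (ℕ × ℕ)} {d : ℕ} (hS : ∀ p ∈ S, p.1 + p.2 ≤ d)
    (c : ℕ × ℕ → ℝ) (hc : ∀ p ∉ S, c p = 0) (x : ℕ) :
    Tendsto (fun k : ℕ =>
      (∑ p ∈ S, c p * ((k * x).choose p.1 : ℝ) * (k.choose p.2 : ℝ)) / (k : ℝ) ^ d) atTop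
      (𝓝 (∑ p ∈ Finset.HasAntidiagonal.antidiagonal d, c p / (p.1 ! * p.2 !) * (x : ℝ) ^ p.1)) := by
  have hterm (p) (hp : p ∈ S) : Tendsto
      (fun k : ℕ => c p * ((k * x).choose p.1 : ℝ) * (k.choose p.2 : ℝ) / (k : ℝ) ^ d) atTop
      (𝓝 (if p.1 + p.2 = d then c p / (p.1 ! * p.2 !) * (x : ℝ) ^ p.1 else 0)) := by
    obtain ⟨s, hs⟩ := Nat.exists_eq_add_of_le (hS p hp)
    have h := (((tendsto_choose_div_pow x 0 p.1).mul (tendsto_choose_div_pow 1 0 p.2)).const_mul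
      (c p)).mul ((tendsto_inv_atTop_nhds_zero_nat (𝕜 := ℝ)).pow s)
    convert h using 2
    · rw [hs, pow_add, pow_add]
      simp only [add_zero, mul_one, inv_pow]
      field_simp
    · rcases Nat.eq_zero_or_pos s with rfl | h0
      · simp only [add_zero] at hs
        simp only [hs, if_true, Nat.cast_one, one_pow, pow_zero]
        ring
      · rw [if_neg (by omega), zero_pow h0.ne', mul_zero]
  have h := tendsto_finsetSum S hterm
  convert h using 2
  · rw [Finset.sum_div]
  · rw [← Finset.sum_filter]
    refine (Finset.sum_subset (fun p hp => ?_) fun p _ hp => ?_).symm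
    · simpa using (Finset.mem_filter.1 hp).2
    · rename_i hp'
      have : p ∉ S := fun h => hp (Finset.mem_filter.2 ⟨h, by simpa using hp'⟩)
      simp [hc p this]

theorem eq_of_sum_antidiagonal_mul_pow_eq {d : ℕ} {f g : ℕ × ℕ → ℝ}
    (h : ∀ x : ℕ, ∑ p ∈ Finset.HasAntidiagonal.antidiagonal d, f p * (x : ℝ) ^ p.1 =
      ∑ p ∈ Finset.HasAntidiagonal.antidiagonal d, g p * (x : ℝ) ^ p.1)
    {p : ℕ × ℕ} (hp : p.1 + p.2 = d) : f p = g p := by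
  let P (f : ℕ × ℕ → ℝ) : Polynomial ℝ :=
    ∑ p ∈ Finset.HasAntidiagonal.antidiagonal d, Polynomial.monomial p.1 (f p)
  have hcoeff (f : ℕ × ℕ → ℝ) : (P f).coeff p.1 = f p := by
    simp only [P, Polynomial.finsetSum_coeff, Polynomial.coeff_monomial]
    rw [Finset.sum_eq_single p]
    · simp
    · intro q hq hne
      refine if_neg fun h1 => hne (Prod.ext h1 ?_)
      have := Finset.HasAntidiagonal.mem_antidiagonal.1 hq
      omega
    · exact fun h => absurd (Finset.HasAntidiagonal.mem_antidiagonal.2 hp) h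
  have hPQ : P f = P g := by
    refine Polynomial.eq_of_infinite_eval_eq _ _
      ((Set.infinite_range_of_injective (Nat.cast_injective (R := ℝ))).mono ?_)
    rintro _ ⟨x, rfl⟩
    simpa [P, Polynomial.eval_finsetSum] using h x
  rw [← hcoeff f, hPQ, hcoeff]

open Filter Topology Nat in
/-- The growth of an integer combination of products of binomial coefficients along all rays
determines its coefficients of top degree. -/
theorem leading_coeff_of_tendsto {S : Finset (ℕ × ℕ)} {n : ℕ} {c b : ℕ × ℕ → ℝ}
    (hS : ∀ p, p ∈ S ↔ c p ≠ 0)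
    (h : ∀ x : ℕ, Tendsto (fun k : ℕ =>
      (∑ p ∈ S, c p * ((k * x).choose p.1 : ℝ) * (k.choose p.2 : ℝ)) / (k : ℝ) ^ n) atTop
      (𝓝 (∑ p ∈ Finset.HasAntidiagonal.antidiagonal n,
        b p / (p.1 ! * p.2 !) * (x : ℝ) ^ p.1))) :
    (∀ p ∈ S, p.1 + p.2 ≤ n) ∧ ∀ p : ℕ × ℕ, p.1 + p.2 = n → c p = b p := by
  have hc (p) (hp : p ∉ S) : c p = 0 := not_not.1 fun h => hp ((hS p).2 h)
  have hdeg : ∀ p ∈ S, p.1 + p.2 ≤ n := by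
    by_contra! hlt
    obtain ⟨q, hq, hqn⟩ := hlt
    obtain ⟨p, hp, hmax⟩ := S.exists_max_image (fun p => p.1 + p.2) ⟨q, hq⟩
    obtain ⟨s, hs⟩ := Nat.exists_eq_add_of_lt (hqn.trans_le (hmax q hq))
    have hz (x : ℕ) := tendsto_nhds_unique (tendsto_sum_choose_div_pow hmax c hc x)
      ((((h x).mul ((tendsto_inv_atTop_nhds_zero_nat (𝕜 := ℝ)).pow (s + 1)))).congr fun k => by
        rw [hs, add_assoc, pow_add, ← pow_add, inv_pow, ← div_eq_mul_inv, div_div,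
          ← pow_add])
    have := eq_of_sum_antidiagonal_mul_pow_eq (g := 0)
      (f := fun p => c p / (p.1 ! * p.2 !)) (fun x => by simpa using hz x) (p := p) rfl
    rw [Pi.zero_apply, div_eq_zero_iff] at this
    exact (hS p).1 hp (this.resolve_right (by positivity))
  refine ⟨hdeg, fun p hp => ?_⟩
  have := eq_of_sum_antidiagonal_mul_pow_eq (f := fun p => c p / (p.1 ! * p.2 !))
    (g := fun p => b p / (p.1 ! * p.2 !))
    (fun x => tendsto_nhds_unique (tendsto_sum_choose_div_pow hdeg c hc x) (h x)) hp
  exact (div_left_inj' (by positivity)).1 this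

theorem coeff_X_sub_one_pow_mul (a b i j : ℕ) :
    MvPolynomial.coeff (Finsupp.single 0 a + Finsupp.single 1 b)
      ((MvPolynomial.X 0 - 1) ^ i * (MvPolynomial.X 1 - 1) ^ j : MvPolynomial (Fin 2) ℤ) =
      ((-1) ^ (i - a) * i.choose a) * ((-1) ^ (j - b) * j.choose b) := by
  have hpow (v : Fin 2) (i : ℕ) : (MvPolynomial.X v - 1 : MvPolynomial (Fin 2) ℤ) ^ i =
      ∑ k ∈ Finset.range (i + 1),
        MvPolynomial.monomial (Finsupp.single v k) ((-1) ^ (i - k) * (i.choose k : ℤ)) := by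
    rw [sub_eq_add_neg, add_pow]
    refine Finset.sum_congr rfl fun k _ => ?_
    rw [← mul_one ((-1 : ℤ) ^ (i - k) * _), ← MvPolynomial.C_mul_monomial,
      ← MvPolynomial.X_pow_eq_monomial]
    simp only [map_mul, map_pow, map_neg, map_one, map_natCast]
    ring
  rw [hpow, hpow, Finset.sum_mul_sum]
  simp_rw [MvPolynomial.monomial_mul, MvPolynomial.coeff_sum, MvPolynomial.coeff_monomial]
  have hinj (k l : ℕ) : (Finsupp.single 0 k + Finsupp.single 1 l : Fin 2 →₀ ℕ) =
      Finsupp.single 0 a + Finsupp.single 1 b ↔ k = a ∧ l = b := by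
    refine ⟨fun h => ⟨by simpa using DFunLike.congr_fun h 0, by simpa using DFunLike.congr_fun h 1⟩,
      fun h => by rw [h.1, h.2]⟩
  simp_rw [hinj, ite_and]
  simp only [Finset.sum_ite_irrel, Finset.sum_const_zero, Finset.sum_ite_eq', Finset.mem_range]
  split_ifs with h1 h2
  · rfl
  · rw [Nat.choose_eq_zero_of_lt (by omega : j < b)]; simp
  · rw [Nat.choose_eq_zero_of_lt (by omega : i < a)]; simp

/-- `Q'_M` has total degree `n − 1` and its top-degree homogeneous
part is `(x + y)^{n−1}`: for `a + b = n − 1` the coefficient of `x^a y^b` is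
`C(n−1, a)`. -/
theorem stmt_7 {α : Type*} [Fintype α] [DecidableEq α] [Nonempty α]
    (M : PolyMatroid α) (hmat : ∀ i : α, M.rk {i} ≤ 1)
    (c : ℕ × ℕ → ℤ) (hc : IsQdatum (matroidPolytope M) c) :
    (QprimePoly c).totalDegree = Fintype.card α - 1 ∧
    ∀ a b : ℕ, a + b = Fintype.card α - 1 →
      MvPolynomial.coeff (Finsupp.single 0 a + Finsupp.single 1 b) (QprimePoly c) =
        ((Fintype.card α - 1).choose a : ℤ) := by
  obtain ⟨hfin, hQ⟩ := hc
  set n := Fintype.card α - 1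
  set S := hfin.toFinset
  have hS (p) : p ∈ S ↔ c p ≠ 0 := by simp [S]
  have hQS (t u : ℕ) : (Qcount (matroidPolytope M) t u : ℝ) =
      ∑ p ∈ S, (c p : ℝ) * (t.choose p.1 : ℝ) * (u.choose p.2 : ℝ) := by
    have h := hQ t u
    rw [finsum_eq_sum_of_support_subset (s := S)] at h
    · exact_mod_cast h
    · intro p hp
      simp only [Finset.mem_coe, hS]
      rintro h0
      simp [h0] at hp
  have hlim (x : ℕ) := tendsto_of_tendsto_of_tendsto_of_le_of_le
    (tendsto_signedBallCard_div_pow n x 0)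
    (tendsto_signedBallCard_div_pow n x (M.rk Finset.univ))
    (f := fun k : ℕ => (Qcount (matroidPolytope M) (k * x) k : ℝ) / (k : ℝ) ^ n)
    (fun k => by
      have := (Qcount_bounds M hmat (k * x) k).1
      dsimp only
      gcongr
      exact this)
    (fun k => by
      have := (Qcount_bounds M hmat (k * x) k).2
      dsimp only
      gcongr)
  simp_rw [hQS] at hlim
  obtain ⟨hdeg, htop⟩ := leading_coeff_of_tendsto (c := fun p => (c p : ℝ))
    (b := fun p => (n.choose p.1 : ℝ)) (by simpa using hS) hlim
  have hpoly : QprimePoly c = ∑ p ∈ S, MvPolynomial.C (c p) *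
      ((MvPolynomial.X 0 - 1) ^ p.1 * (MvPolynomial.X 1 - 1) ^ p.2) := by
    rw [QprimePoly, finsum_eq_sum_of_support_subset (s := S)]
    · simp_rw [mul_assoc]
    · intro p hp
      simp only [Finset.mem_coe, hS]
      rintro h0
      simp [h0] at hp
  have hcoeff (a b : ℕ) (hab : a + b = n) :
      MvPolynomial.coeff (Finsupp.single 0 a + Finsupp.single 1 b) (QprimePoly c) =
        (n.choose a : ℤ) := by
    have hab' : c (a, b) = n.choose a := by exact_mod_cast htop (a, b) hab
    rw [hpoly, MvPolynomial.coeff_sum, ← hab']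
    simp_rw [MvPolynomial.coeff_C_mul, coeff_X_sub_one_pow_mul]
    rw [Finset.sum_eq_single (a, b)]
    · simp
    · rintro ⟨i, j⟩ hp hne
      have h1 : i + j ≤ n := hdeg _ hp
      rcases lt_or_ge i a with h | h
      · simp [Nat.choose_eq_zero_of_lt h]
      · rcases lt_or_ge j b with h' | h'
        · simp [Nat.choose_eq_zero_of_lt h']
        · exact absurd (Prod.ext (by dsimp only; omega) (by dsimp only; omega)) hne
    · intro h
      rw [hS, not_not] at h
      simp [h]
  refine ⟨le_antisymm ?_ ?_, hcoeff⟩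
  · rw [hpoly]
    refine MvPolynomial.totalDegree_finsetSum_le fun p hp => ?_
    have hX (v : Fin 2) (i : ℕ) :
        ((MvPolynomial.X v - 1 : MvPolynomial (Fin 2) ℤ) ^ i).totalDegree ≤ i := by
      refine (MvPolynomial.totalDegree_pow _ _).trans ?_
      have : (MvPolynomial.X v - 1 : MvPolynomial (Fin 2) ℤ).totalDegree ≤ 1 :=
        (MvPolynomial.totalDegree_sub _ _).trans (by simp)
      nlinarith
    refine (MvPolynomial.totalDegree_mul _ _).trans ?_
    rw [MvPolynomial.totalDegree_C, zero_add]
    exact (MvPolynomial.totalDegree_mul _ _).trans ((add_le_add (hX 0 _) (hX 1 _)).trans (hdeg p hp))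
  · have h := MvPolynomial.le_totalDegree (p := QprimePoly c)
      (s := Finsupp.single 0 n + Finsupp.single 1 0)
      (by rw [MvPolynomial.mem_support_iff, hcoeff n 0 rfl]; simp)
    simpa using h

end
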